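/- Let ℓ be a bounded proper scoring loss; let Q and Q* be PMFs on X × Y with Q*_X(x) > 0 for all x ∈ X; let h*(x) := Q*(·|x); and assume R_Q(h*,ℓ) ≤ R_{Q*}(h*,ℓ). If CE_Q(h*,ℓ) = 0, then RF_Q(h*,ℓ) ≤ B_{Q*}(ℓ). In particular, if moreover Q_X(x) > 0 for all x ∈ X and h* is canonically calibrated under Q, then Σ_x Q_X(x)·H_ℓ(Q*(·|x)) ≤ Σ_x Q*_X(x)·H_ℓ(Q*(·|x)). -/

import Mathlib

open Finset
open scoped Classical

noncomputable section

/-- The standard probability simplex over a finite type `Y`. -/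
def simplex (Y : Type*) [Fintype Y] : Set (Y → ℝ) :=
  {p | (∀ y, 0 ≤ p y) ∧ ∑ y, p y = 1}

variable {X Y : Type*}

/-- Expected loss `L(p,q) = Σ_y p(y)·ℓ(y,q)`. -/
def expLoss [Fintype Y] (ℓ : Y → (Y → ℝ) → ℝ) (p q : Y → ℝ) : ℝ :=
  ∑ y, p y * ℓ y q

/-- A scoring loss is bounded by `M` if `0 ≤ ℓ(y,q) ≤ M` for all `y` and `q ∈ Δ^Y`. -/
def IsBoundedLoss [Fintype Y] (ℓ : Y → (Y → ℝ) → ℝ) (M : ℝ) : Prop :=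
  ∀ y : Y, ∀ q ∈ simplex Y, 0 ≤ ℓ y q ∧ ℓ y q ≤ M

/-- A scoring loss is proper if `L(p,p) ≤ L(p,q)` for all `p, q ∈ Δ^Y`. -/
def IsProper [Fintype Y] (ℓ : Y → (Y → ℝ) → ℝ) : Prop :=
  ∀ p ∈ simplex Y, ∀ q ∈ simplex Y, expLoss ℓ p p ≤ expLoss ℓ p q

/-- Generalized entropy `H_ℓ(p) = inf_{q ∈ Δ^Y} L(p,q)`. -/
def genEnt [Fintype Y] (ℓ : Y → (Y → ℝ) → ℝ) (p : Y → ℝ) : ℝ :=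
  sInf ((fun q => expLoss ℓ p q) '' simplex Y)

/-- Bregman divergence `d_ℓ(p,q) = L(p,q) − H_ℓ(p)`. -/
def breg [Fintype Y] (ℓ : Y → (Y → ℝ) → ℝ) (p q : Y → ℝ) : ℝ :=
  expLoss ℓ p q - genEnt ℓ p

/-- A probability mass function on `X × Y`. -/
def IsPMF [Fintype X] [Fintype Y] (P : X × Y → ℝ) : Prop :=
  (∀ z, 0 ≤ P z) ∧ ∑ z, P z = 1

/-- The `X`-marginal `P_X(x) = Σ_y P(x,y)`. -/
def margX [Fintype Y] (P : X × Y → ℝ) (x : X) : ℝ := ∑ y, P (x, y)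

/-- The conditional distribution `P(·|x)`. -/
def condY [Fintype Y] (P : X × Y → ℝ) (x : X) : Y → ℝ :=
  fun y => P (x, y) / margX P x

/-- Risk `R_P(h,ℓ) = Σ_{x,y} P(x,y)·ℓ(y,h(x))`. -/
def risk [Fintype X] [Fintype Y] (P : X × Y → ℝ) (h : X → Y → ℝ)
    (ℓ : Y → (Y → ℝ) → ℝ) : ℝ :=
  ∑ z : X × Y, P z * ℓ z.2 (h z.1)

/-- The weight `w_ν = Σ_{x : h(x)=ν} P_X(x)`. -/
def weight [Fintype X] [Fintype Y] (P : X × Y → ℝ) (h : X → Y → ℝ) (ν : Y → ℝ) : ℝ :=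
  ∑ x ∈ univ.filter (fun x => h x = ν), margX P x

/-- The conditional outcome distribution `P(·|h=ν)`. -/
def condOut [Fintype X] [Fintype Y] (P : X × Y → ℝ) (h : X → Y → ℝ) (ν : Y → ℝ) : Y → ℝ :=
  fun y => (∑ x ∈ univ.filter (fun x => h x = ν), P (x, y)) / weight P h ν

/-- `h` is canonically calibrated under `P` if `P(·|h=ν) = ν` whenever `w_ν > 0`. -/
def Calibrated [Fintype X] [Fintype Y] (P : X × Y → ℝ) (h : X → Y → ℝ) : Prop :=
  ∀ ν : Y → ℝ, 0 < weight P h ν → condOut P h ν = ν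

/-- Calibration error `CE_P(h,ℓ) = Σ_{ν : w_ν>0} w_ν · d_ℓ(P(·|h=ν), ν)`,
the sum ranging over the (finitely many) values in the range of `h`. -/
def CE [Fintype X] [Fintype Y] (P : X × Y → ℝ) (h : X → Y → ℝ)
    (ℓ : Y → (Y → ℝ) → ℝ) : ℝ :=
  ∑ ν ∈ (univ.image h).filter (fun ν => 0 < weight P h ν),
    weight P h ν * breg ℓ (condOut P h ν) ν

/-- Refinement `RF_P(h,ℓ) = Σ_{ν : w_ν>0} w_ν · H_ℓ(P(·|h=ν))`. -/
def RF [Fintype X] [Fintype Y] (P : X × Y → ℝ) (h : X → Y → ℝ)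
    (ℓ : Y → (Y → ℝ) → ℝ) : ℝ :=
  ∑ ν ∈ (univ.image h).filter (fun ν => 0 < weight P h ν),
    weight P h ν * genEnt ℓ (condOut P h ν)

/-- Bayes refinement `B_P(ℓ) = Σ_{x : P_X(x)>0} P_X(x) · H_ℓ(P(·|x))`. -/
def BayesRF [Fintype X] [Fintype Y] (P : X × Y → ℝ) (ℓ : Y → (Y → ℝ) → ℝ) : ℝ :=
  ∑ x ∈ univ.filter (fun x => 0 < margX P x), margX P x * genEnt ℓ (condY P x)

/-- The optimal (Bayes) value `V(Q) = inf_{h : X → Δ^Y} R_Q(h,ℓ)`. -/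
def mdlV [Fintype X] [Fintype Y] (ℓ : Y → (Y → ℝ) → ℝ) (Q : X × Y → ℝ) : ℝ :=
  sInf {r : ℝ | ∃ h : X → Y → ℝ, (∀ x, h x ∈ simplex Y) ∧ r = risk Q h ℓ}

lemma genEnt_eq_expLoss_self [Fintype Y] {ℓ : Y → (Y → ℝ) → ℝ} (hp : IsProper ℓ)
    {p : Y → ℝ} (hpm : p ∈ simplex Y) : genEnt ℓ p = expLoss ℓ p p :=
  IsLeast.csInf_eq ⟨⟨p, hpm, rfl⟩, by rintro _ ⟨q, hq, rfl⟩; exact hp p hpm q hq⟩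

lemma margX_nonneg [Fintype Y] {P : X × Y → ℝ} (hP : ∀ z, 0 ≤ P z) (x : X) :
    0 ≤ margX P x :=
  sum_nonneg fun _ _ => hP _

lemma condY_mem_simplex [Fintype Y] {P : X × Y → ℝ} (hP : ∀ z, 0 ≤ P z) {x : X}
    (hx : 0 < margX P x) : condY P x ∈ simplex Y := by
  refine ⟨fun y => div_nonneg (hP _) hx.le, ?_⟩
  simp only [condY, ← sum_div]
  exact div_self hx.ne'

lemma margX_mul_expLoss_condY [Fintype Y] {P : X × Y → ℝ} {x : X} (hx : 0 < margX P x)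
    (ℓ : Y → (Y → ℝ) → ℝ) (q : Y → ℝ) :
    margX P x * expLoss ℓ (condY P x) q = ∑ y, P (x, y) * ℓ y q := by
  have := hx.ne'
  simp only [expLoss, condY, mul_sum]
  exact sum_congr rfl fun y _ => by field_simp

section Predictor

variable [Fintype X] [Fintype Y] {P : X × Y → ℝ} {h : X → Y → ℝ}

lemma margX_eq_zero_of_weight_not_pos (hP : ∀ z, 0 ≤ P z) {x : X}
    (hx : ¬ 0 < weight P h (h x)) : margX P x = 0 := by
  refine le_antisymm (le_trans ?_ (not_lt.mp hx)) (margX_nonneg hP x)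
  exact single_le_sum (f := margX P) (fun i _ => margX_nonneg hP i) (by simp)

lemma weight_mul_expLoss_condOut {ν : Y → ℝ} (hν : 0 < weight P h ν)
    (ℓ : Y → (Y → ℝ) → ℝ) :
    weight P h ν * expLoss ℓ (condOut P h ν) ν =
      ∑ x ∈ univ.filter (fun x => h x = ν), ∑ y, P (x, y) * ℓ y (h x) := by
  have := hν.ne'
  have hfib : ∑ x ∈ univ.filter (fun x => h x = ν), ∑ y, P (x, y) * ℓ y (h x) =
      ∑ x ∈ univ.filter (fun x => h x = ν), ∑ y, P (x, y) * ℓ y ν :=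
    sum_congr rfl fun x hx => by rw [(mem_filter.mp hx).2]
  rw [hfib, sum_comm]
  simp only [expLoss, condOut, mul_sum, ← sum_mul]
  exact sum_congr rfl fun y _ => by field_simp

/-- Group a sum over `X` by the values of `h`, dropping the values of zero weight. -/
lemma sum_fiberwise_of_weight_pos (hP : ∀ z, 0 ≤ P z) {f : X → ℝ}
    (hf : ∀ x, margX P x = 0 → f x = 0) :
    ∑ ν ∈ (univ.image h).filter (fun ν => 0 < weight P h ν),
      ∑ x ∈ univ.filter (fun x => h x = ν), f x = ∑ x, f x := by
  rw [sum_filter_of_ne]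
  · exact sum_fiberwise_of_maps_to (fun x _ => mem_image_of_mem h (mem_univ x)) f
  · intro ν _ hne
    by_contra hν
    refine hne (sum_eq_zero fun x hx => hf x ?_)
    obtain rfl := (mem_filter.mp hx).2
    exact margX_eq_zero_of_weight_not_pos hP hν

/-- The calibration-refinement decomposition of the risk. -/
lemma risk_eq_CE_add_RF (hP : ∀ z, 0 ≤ P z) (ℓ : Y → (Y → ℝ) → ℝ) :
    risk P h ℓ = CE P h ℓ + RF P h ℓ := by
  rw [CE, RF, ← sum_add_distrib, risk, Fintype.sum_prod_type]
  rw [← sum_fiberwise_of_weight_pos (h := h) hP]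
  · refine sum_congr rfl fun ν hν => ?_
    rw [← weight_mul_expLoss_condOut (mem_filter.mp hν).2, breg]
    ring
  · intro x hx
    refine sum_eq_zero fun y _ => ?_
    rw [(sum_eq_zero_iff_of_nonneg fun _ _ => hP _).mp hx y (mem_univ y), zero_mul]

lemma risk_condY_eq_BayesRF {ℓ : Y → (Y → ℝ) → ℝ} (hp : IsProper ℓ) (hP : ∀ z, 0 ≤ P z)
    (hpos : ∀ x, 0 < margX P x) :
    risk P (fun x => condY P x) ℓ = BayesRF P ℓ := by
  rw [BayesRF, filter_true_of_mem fun x _ => hpos x, risk, Fintype.sum_prod_type]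
  refine sum_congr rfl fun x _ => ?_
  rw [genEnt_eq_expLoss_self hp (condY_mem_simplex hP (hpos x)),
    margX_mul_expLoss_condY (hpos x)]

lemma Calibrated.CE_eq_zero {ℓ : Y → (Y → ℝ) → ℝ} (hp : IsProper ℓ)
    (hh : ∀ x, h x ∈ simplex Y) (hc : Calibrated P h) : CE P h ℓ = 0 := by
  refine sum_eq_zero fun ν hν => ?_
  obtain ⟨hmem, hw⟩ := mem_filter.mp hν
  obtain ⟨x, -, rfl⟩ := mem_image.mp hmem
  rw [hc _ hw, breg, genEnt_eq_expLoss_self hp (hh x), sub_self, mul_zero]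

lemma Calibrated.RF_eq (hP : ∀ z, 0 ≤ P z) (hc : Calibrated P h) (ℓ : Y → (Y → ℝ) → ℝ) :
    RF P h ℓ = ∑ x, margX P x * genEnt ℓ (h x) := by
  rw [RF, ← sum_fiberwise_of_weight_pos (h := h) hP fun x hx => by rw [hx, zero_mul]]
  refine sum_congr rfl fun ν hν => ?_
  rw [hc _ (mem_filter.mp hν).2, weight, sum_mul]
  exact sum_congr rfl fun x hx => by rw [(mem_filter.mp hx).2]

end Predictor

/-- under the saddle-point inequality, if `CE_Q(h*,ℓ) = 0` then
`RF_Q(h*,ℓ) ≤ B_{Q*}(ℓ)`; in particular, if `Q_X > 0` everywhere and `h*` is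
canonically calibrated under `Q`, then
`Σ_x Q_X(x)·H_ℓ(Q*(·|x)) ≤ Σ_x Q*_X(x)·H_ℓ(Q*(·|x))`. -/
theorem zero_calibration_error_consequence
    [Fintype X] [Fintype Y] [Nonempty X] [Nonempty Y]
    (ℓ : Y → (Y → ℝ) → ℝ) (M : ℝ) (hb : IsBoundedLoss ℓ M) (hp : IsProper ℓ)
    (Q Qs : X × Y → ℝ) (hQ : IsPMF Q) (hQs : IsPMF Qs)
    (hpos : ∀ x, 0 < margX Qs x)
    (hsaddle : risk Q (fun x => condY Qs x) ℓ ≤ risk Qs (fun x => condY Qs x) ℓ) :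
    (CE Q (fun x => condY Qs x) ℓ = 0 →
      RF Q (fun x => condY Qs x) ℓ ≤ BayesRF Qs ℓ) ∧
    ((∀ x, 0 < margX Q x) → Calibrated Q (fun x => condY Qs x) →
      ∑ x, margX Q x * genEnt ℓ (condY Qs x) ≤
        ∑ x, margX Qs x * genEnt ℓ (condY Qs x)) := by
  have key : CE Q (fun x => condY Qs x) ℓ = 0 →
      RF Q (fun x => condY Qs x) ℓ ≤ BayesRF Qs ℓ := fun hCE => by
    rwa [risk_eq_CE_add_RF hQ.1, hCE, zero_add, risk_condY_eq_BayesRF hp hQs.1 hpos] at hsaddle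
  refine ⟨key, fun _ hc => ?_⟩
  have hle := key (hc.CE_eq_zero hp fun x => condY_mem_simplex hQs.1 (hpos x))
  rwa [hc.RF_eq hQ.1, BayesRF, filter_true_of_mem fun x _ => hpos x] at hle

end
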